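/- arXiv:2508.03171 — 2 statements merged into one kernel-verified Lean document; each statement's English description precedes it below -/
import Mathlib

section
/- Let E be a real inner product space, K ≥ 1, and for each k = 1, …, K let f_k : E → ℝ be convex, differentiable, and L-smooth (L > 0) with a global minimizer w_k* ∈ E. Let λ₁, …, λ_K be nonnegative reals with Σ_k λ_k = 1, let η > 0, let w₁, …, w_K ∈ E, let w* ∈ E, and set w̄ = Σ_k λ_k w_k. Then Σ_k λ_k (f_k(w_k) − f_k(w*)) ≥ Σ_k λ_k (f_k(w̄) − f_k(w*)) − Σ_k λ_k ( ηL (f_k(w̄) − f_k(w_k*)) + (1/(2η)) ‖w_k − w̄‖² ). -/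
/-- Young's inequality for the inner product. -/
theorem neg_inner_le_add_norm_sq {E : Type*} [NormedAddCommGroup E] [InnerProductSpace ℝ E]
    (u v : E) {η : ℝ} (hη : 0 < η) :
    -inner ℝ u v ≤ η / 2 * ‖u‖ ^ 2 + 1 / (2 * η) * ‖v‖ ^ 2 := by
  have hsq : η / 2 * ‖u‖ ^ 2 + 1 / (2 * η) * ‖v‖ ^ 2 + inner ℝ u v =
      1 / (2 * η) * ‖η • u + v‖ ^ 2 := by
    rw [norm_add_sq_real, norm_smul, Real.norm_of_nonneg hη.le, real_inner_smul_left]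
    field_simp
    ring
  have hnonneg : 0 ≤ 1 / (2 * η) * ‖η • u + v‖ ^ 2 := by positivity
  linarith

section Gradient

variable {E : Type*} [NormedAddCommGroup E] [InnerProductSpace ℝ E] [CompleteSpace E]
  {f : E → ℝ}

theorem hasDerivAt_comp_add_smul_of_differentiable (hf : Differentiable ℝ f) (x v : E) (t : ℝ) :
    HasDerivAt (fun s : ℝ => f (x + s • v)) (inner ℝ (gradient f (x + t • v)) v) t := by
  have hline : HasDerivAt (fun s : ℝ => x + s • v) v t := by
    simpa using ((hasDerivAt_id t).smul_const v).const_add x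
  rw [inner_gradient_left]
  exact (hf _).hasFDerivAt.comp_hasDerivAt t hline

/-- A differentiable convex function lies above its tangent hyperplanes. -/
theorem ConvexOn.add_inner_gradient_le (hconv : ConvexOn ℝ Set.univ f) (hf : Differentiable ℝ f)
    (x y : E) : f x + inner ℝ (gradient f x) (y - x) ≤ f y := by
  have hline : ConvexOn ℝ Set.univ (fun s : ℝ => f (x + s • (y - x))) := by
    simpa [Function.comp_def, AffineMap.lineMap_apply, add_comm] using
      hconv.comp_affineMap (AffineMap.lineMap x y : ℝ →ᵃ[ℝ] E)
  have h := hline.le_slope_of_hasDerivAt (Set.mem_univ 0) (Set.mem_univ 1) one_pos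
    (hasDerivAt_comp_add_smul_of_differentiable hf x (y - x) 0)
  simp only [slope_def_field, zero_smul, add_zero, one_smul, add_sub_cancel, sub_zero, div_one] at h
  linarith

/-- The descent lemma: an `L`-smooth function lies below its quadratic upper model. -/
theorem le_add_inner_gradient_add_of_lipschitz_gradient (hf : Differentiable ℝ f) {L : ℝ}
    (hsmooth : ∀ a b : E, ‖gradient f a - gradient f b‖ ≤ L * ‖a - b‖) (x v : E) :
    f (x + v) ≤ f x + inner ℝ (gradient f x) v + L / 2 * ‖v‖ ^ 2 := by
  let h : ℝ → ℝ := fun t =>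
    f (x + t • v) - (t * inner ℝ (gradient f x) v + t ^ 2 * (L / 2 * ‖v‖ ^ 2))
  have hderiv (t : ℝ) : HasDerivAt h (inner ℝ (gradient f (x + t • v)) v -
      (inner ℝ (gradient f x) v + 2 * t * (L / 2 * ‖v‖ ^ 2))) t := by
    refine (hasDerivAt_comp_add_smul_of_differentiable hf x v t).sub (HasDerivAt.add ?_ ?_)
    · simpa using (hasDerivAt_id t).mul_const (inner ℝ (gradient f x) v)
    · simpa using (hasDerivAt_pow 2 t).mul_const (L / 2 * ‖v‖ ^ 2)
  have hanti : AntitoneOn h (Set.Icc 0 1) := by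
    refine antitoneOn_of_deriv_nonpos (convex_Icc 0 1)
      (fun t _ => (hderiv t).continuousAt.continuousWithinAt)
      (fun t _ => (hderiv t).differentiableAt.differentiableWithinAt) fun t ht => ?_
    rw [interior_Icc] at ht
    rw [(hderiv t).deriv]
    have hinner := real_inner_le_norm (gradient f (x + t • v) - gradient f x) v
    have hgrad := hsmooth (x + t • v) x
    rw [add_sub_cancel_left, norm_smul, Real.norm_of_nonneg ht.1.le] at hgrad
    rw [inner_sub_left] at hinner
    nlinarith [mul_le_mul_of_nonneg_right hgrad (norm_nonneg v)]
  have h01 := hanti (Set.left_mem_Icc.2 zero_le_one) (Set.right_mem_Icc.2 zero_le_one) zero_le_one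
  simp only [h, zero_smul, one_smul, add_zero, zero_mul, one_mul, one_pow, sub_zero,
    zero_pow two_ne_zero] at h01
  linarith

/-- The squared gradient norm of an `L`-smooth function is controlled by the suboptimality gap. -/
theorem norm_gradient_sq_le_of_lipschitz_gradient (hf : Differentiable ℝ f) {L : ℝ} (hL : 0 < L)
    (hsmooth : ∀ a b : E, ‖gradient f a - gradient f b‖ ≤ L * ‖a - b‖) {m : ℝ}
    (hm : ∀ x, m ≤ f x) (x : E) : ‖gradient f x‖ ^ 2 ≤ 2 * L * (f x - m) := by
  have h := (hm _).trans
    (le_add_inner_gradient_add_of_lipschitz_gradient hf hsmooth x (-L⁻¹ • gradient f x))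
  rw [inner_smul_right, real_inner_self_eq_norm_sq, norm_smul, norm_neg,
    Real.norm_of_nonneg (inv_nonneg.2 hL.le)] at h
  have hquad : f x + -L⁻¹ * ‖gradient f x‖ ^ 2 + L / 2 * (L⁻¹ * ‖gradient f x‖) ^ 2 =
      f x - ‖gradient f x‖ ^ 2 / (2 * L) := by
    field_simp
    ring
  rw [hquad] at h
  have hdiv : ‖gradient f x‖ ^ 2 / (2 * L) ≤ f x - m := by linarith
  rwa [div_le_iff₀' (by positivity)] at hdiv

end Gradient

/-- Lower bound (C.2) on the term C₁: for convex, differentiable, `L`-smooth `f k` with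
global minimizers `wstar k`, convex weights `lam k`, `η > 0`, points `w k`, `wopt`, and
`wbar = Σ_k lam k • w k`,
`Σ_k lam k (f_k(w k) − f_k(wopt)) ≥ Σ_k lam k (f_k(wbar) − f_k(wopt))
  − Σ_k lam k (ηL(f_k(wbar) − f_k(wstar k)) + (1/(2η))‖w k − wbar‖²)`. -/
theorem stmt_7 {E : Type*} [NormedAddCommGroup E] [InnerProductSpace ℝ E] [CompleteSpace E]
    (K : ℕ) (hK : 1 ≤ K) (f : Fin K → E → ℝ) (L : ℝ) (hL : 0 < L)
    (hconv : ∀ k, ConvexOn ℝ Set.univ (f k))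
    (hdiff : ∀ k, Differentiable ℝ (f k))
    (hsmooth : ∀ k, ∀ a b : E, ‖gradient (f k) a - gradient (f k) b‖ ≤ L * ‖a - b‖)
    (wstar : Fin K → E) (hmin : ∀ k, ∀ x : E, f k (wstar k) ≤ f k x)
    (lam : Fin K → ℝ) (hlam : ∀ k, 0 ≤ lam k) (hsum : ∑ k, lam k = 1)
    (η : ℝ) (hη : 0 < η)
    (w : Fin K → E) (wopt : E) (wbar : E) (hwbar : wbar = ∑ k, lam k • w k) :
    ∑ k, lam k * (f k (w k) - f k wopt) ≥
      (∑ k, lam k * (f k wbar - f k wopt)) -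
        ∑ k, lam k * (η * L * (f k wbar - f k (wstar k)) + (1 / (2 * η)) * ‖w k - wbar‖ ^ 2) := by
  rw [ge_iff_le, ← Finset.sum_sub_distrib]
  refine Finset.sum_le_sum fun k _ => ?_
  rw [← mul_sub]
  refine mul_le_mul_of_nonneg_left ?_ (hlam k)
  have htangent := (hconv k).add_inner_gradient_le (hdiff k) wbar (w k)
  have hyoung := neg_inner_le_add_norm_sq (gradient (f k) wbar) (w k - wbar) hη
  have hgrad := mul_le_mul_of_nonneg_left
    (norm_gradient_sq_le_of_lipschitz_gradient (hdiff k) hL (hsmooth k) (hmin k) wbar)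
    (half_pos hη).le
  linarith
end

section
/- Let E be a real inner product space, K ≥ 1, and for each k = 1, …, K let f_k : E → ℝ be differentiable, μ-strongly convex (μ > 0), and L-smooth (L > 0) with a global minimizer w_k* ∈ E. Let λ₁, …, λ_K be nonnegative reals with Σ_k λ_k = 1, let w* ∈ E be a global minimizer of F(x) = Σ_k λ_k f_k(x), and suppose ‖w* − w_k*‖² ≤ ε_w for every k, where ε_w ≥ 0. Let 0 < η ≤ 1/(2L) and set ζ = 2η(1 − 2ηL). Then for any w₁, …, w_K ∈ E with w̄ = Σ_k λ_k w_k: ‖ w̄ − η Σ_k λ_k ∇f_k(w_k) − w* ‖² ≤ (1 − ημ) ‖w̄ − w*‖² + (ηL²ε_w/2)(ζ + 4η) + (1 + ζ/(2η)) Σ_k λ_k ‖w_k − w̄‖². -/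
open RealInnerProductSpace

section SmoothConvex

variable {E : Type*} [NormedAddCommGroup E] [InnerProductSpace ℝ E]

/-- Jensen's inequality for the squared norm. -/
lemma norm_sq_sum_smul_le {ι : Type*} [Fintype ι] (lam : ι → ℝ)
    (hlam : ∀ k, 0 ≤ lam k) (hsum : ∑ k, lam k = 1) (v : ι → E) :
    ‖∑ k, lam k • v k‖ ^ 2 ≤ ∑ k, lam k * ‖v k‖ ^ 2 := by
  have h : ConvexOn ℝ Set.univ (fun x : E => ‖x‖ ^ 2) :=
    (convexOn_norm convex_univ).pow (fun x _ => norm_nonneg x) 2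
  simpa using h.map_sum_le (t := Finset.univ) (w := lam) (p := v)
    (fun k _ => hlam k) hsum (fun k _ => Set.mem_univ _)

variable [CompleteSpace E] {f : E → ℝ} {L : ℝ}

/-- The descent lemma. -/
lemma le_add_inner_gradient_add_sq (hf : Differentiable ℝ f)
    (hL : ∀ a b : E, ‖gradient f a - gradient f b‖ ≤ L * ‖a - b‖) (a b : E) :
    f b ≤ f a + ⟪gradient f a, b - a⟫ + L / 2 * ‖b - a‖ ^ 2 := by
  set v := b - a with hv
  have hderiv : ∀ t : ℝ, HasDerivAt
      (fun t : ℝ => f (a + t • v) - t * ⟪gradient f a, v⟫ - t ^ 2 * (L / 2 * ‖v‖ ^ 2))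
      (⟪gradient f (a + t • v), v⟫ - 1 * ⟪gradient f a, v⟫
        - (2 * t) * (L / 2 * ‖v‖ ^ 2)) t := by
    intro t
    have hline : HasDerivAt (fun t : ℝ => a + t • v) v t := by
      simpa using ((hasDerivAt_id t).smul_const v).const_add a
    have hcomp := (hf (a + t • v)).hasGradientAt.hasFDerivAt.comp_hasDerivAt t hline
    have hsq : HasDerivAt (fun t : ℝ => t ^ 2) (2 * t) t := by
      simpa using hasDerivAt_pow 2 t
    exact (hcomp.sub ((hasDerivAt_id t).mul_const _)).sub (hsq.mul_const _)
  have hanti := antitoneOn_of_deriv_nonpos (convex_Icc (0 : ℝ) 1)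
    (fun t _ => (hderiv t).continuousAt.continuousWithinAt)
    (fun t _ => (hderiv t).differentiableAt.differentiableWithinAt) (fun t ht => by
      rw [interior_Icc] at ht
      rw [(hderiv t).deriv]
      have hinner := real_inner_le_norm (gradient f (a + t • v) - gradient f a) v
      rw [inner_sub_left] at hinner
      have hnorm := hL (a + t • v) a
      rw [add_sub_cancel_left, norm_smul, Real.norm_of_nonneg ht.1.le] at hnorm
      nlinarith [mul_le_mul_of_nonneg_right hnorm (norm_nonneg v)])
  have h01 := hanti (Set.left_mem_Icc.2 zero_le_one) (Set.right_mem_Icc.2 zero_le_one)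
    zero_le_one
  have hb : a + v = b := by rw [hv]; abel
  simp only [one_smul, zero_smul, add_zero, hb] at h01
  linarith

/-- The gradient of a smooth function is controlled by its gap to any lower bound. -/
lemma norm_gradient_sq_le (hf : Differentiable ℝ f) (hL0 : 0 < L)
    (hL : ∀ a b : E, ‖gradient f a - gradient f b‖ ≤ L * ‖a - b‖) {m : ℝ}
    (hm : ∀ x, m ≤ f x) (a : E) :
    ‖gradient f a‖ ^ 2 ≤ 2 * L * (f a - m) := by
  have h := (hm _).trans
    (le_add_inner_gradient_add_sq hf hL a (a - (1 / L) • gradient f a))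
  have hsub : a - (1 / L) • gradient f a - a = -((1 / L) • gradient f a) := by abel
  rw [hsub, norm_neg, norm_smul, inner_neg_right, inner_smul_right,
    real_inner_self_eq_norm_sq, Real.norm_of_nonneg (by positivity)] at h
  have heq : f a + -(1 / L * ‖gradient f a‖ ^ 2) + L / 2 * (1 / L * ‖gradient f a‖) ^ 2
      = f a - ‖gradient f a‖ ^ 2 / (2 * L) := by
    field_simp
    ring
  rw [heq] at h
  have h' : ‖gradient f a‖ ^ 2 / (2 * L) ≤ f a - m := by linarith
  rw [div_le_iff₀ (by positivity)] at h'
  linarith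

/-- The suboptimality of a smooth function is controlled by the distance to a minimizer. -/
lemma sub_le_of_isMin (hf : Differentiable ℝ f)
    (hL : ∀ a b : E, ‖gradient f a - gradient f b‖ ≤ L * ‖a - b‖) {z : E}
    (hz : ∀ x, f z ≤ f x) (x : E) :
    f x - f z ≤ L / 2 * ‖x - z‖ ^ 2 := by
  have hgrad : gradient f z = 0 := by
    have hmin : IsLocalMin f z := Filter.Eventually.of_forall hz
    rw [gradient, hmin.fderiv_eq_zero, map_zero]
  have h := le_add_inner_gradient_add_sq hf hL z x
  rw [hgrad, inner_zero_left] at h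
  linarith

/-- One gradient step on a single function, with the gradient evaluated at `y` but the step
taken from `x`, compared with a reference point `p`. -/
lemma norm_sub_smul_gradient_sub_sq_le (hf : Differentiable ℝ f) (hL0 : 0 < L)
    (hL : ∀ a b : E, ‖gradient f a - gradient f b‖ ≤ L * ‖a - b‖) {μ : ℝ} (hμ : 0 ≤ μ)
    (hsc : ∀ a b : E, f b ≥ f a + ⟪gradient f a, b - a⟫ + (μ / 2) * ‖b - a‖ ^ 2)
    {m : ℝ} (hm : ∀ x, m ≤ f x) {η : ℝ} (hη : 0 < η) (hηL : η * L ≤ 1 / 2) (x y p : E) :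
    ‖x - η • gradient f y - p‖ ^ 2 ≤ ‖x - p‖ ^ 2 - η * μ * ‖y - p‖ ^ 2
      + (1 + (1 - 2 * η * L)) * ‖y - x‖ ^ 2
      - 2 * η * (1 - 2 * η * L) * (1 - η * L) * (f x - f p)
      + η * L * (2 * η * (1 - 2 * η * L) + 4 * η) * (f p - m) := by
  have hexp : ‖x - η • gradient f y - p‖ ^ 2
      = ‖x - p‖ ^ 2 + 2 * η * ⟪gradient f y, y - x⟫ + 2 * η * ⟪gradient f y, p - y⟫
        + η ^ 2 * ‖gradient f y‖ ^ 2 := by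
    have h1 : x - η • gradient f y - p = (x - p) - η • gradient f y := by abel
    have h2 : ⟪gradient f y, x - p⟫ = -⟪gradient f y, y - x⟫ - ⟪gradient f y, p - y⟫ := by
      rw [← inner_neg_right, ← inner_sub_right]
      congr 1
      abel
    rw [h1, norm_sub_sq_real, inner_smul_right, real_inner_comm, h2, norm_smul,
      Real.norm_of_nonneg hη.le]
    ring
  have hyoung : 2 * η * ⟪gradient f y, y - x⟫
      ≤ η ^ 2 * ‖gradient f y‖ ^ 2 + ‖y - x‖ ^ 2 := by
    have h := sq_nonneg ‖η • gradient f y - (y - x)‖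
    rw [norm_sub_sq_real, real_inner_smul_left, norm_smul, Real.norm_of_nonneg hη.le] at h
    linarith
  have hyoung' : -(η ^ 2 * ‖gradient f x‖ ^ 2 + ‖y - x‖ ^ 2)
      ≤ 2 * η * ⟪gradient f x, y - x⟫ := by
    have h := sq_nonneg ‖η • gradient f x + (y - x)‖
    rw [norm_add_sq_real, real_inner_smul_left, norm_smul, Real.norm_of_nonneg hη.le] at h
    linarith
  have hgy := mul_le_mul_of_nonneg_left (norm_gradient_sq_le hf hL0 hL hm y) (sq_nonneg η)
  have hgx := mul_le_mul_of_nonneg_left (norm_gradient_sq_le hf hL0 hL hm x) (sq_nonneg η)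
  have hp := mul_le_mul_of_nonneg_left (hsc y p) (by positivity : 0 ≤ 2 * η)
  rw [norm_sub_rev p y] at hp
  have hxy : f x + ⟪gradient f x, y - x⟫ ≤ f y := by
    have : 0 ≤ μ / 2 * ‖y - x‖ ^ 2 := by positivity
    linarith [hsc x y]
  have hxy' := mul_le_mul_of_nonneg_left hxy (by positivity : 0 ≤ 2 * η)
  have hdrift : 0 ≤ 2 * η * (f y - f x) + η ^ 2 * (2 * L * (f x - m)) + ‖y - x‖ ^ 2 := by
    linarith
  have hscaled := mul_nonneg (by linarith : 0 ≤ 1 - 2 * η * L) hdrift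
  rw [hexp]
  linarith

end SmoothConvex

/-- The deterministic one-step contraction bound (A.7) on
`A₂ = wbar − wopt − η Σ_k lam k • ∇f_k(w k)`: for differentiable, `μ`-strongly convex and
`L`-smooth `f k` with global minimizers `wstar k`, convex weights `lam k`, a global
minimizer `wopt` of `F = Σ_k lam k * f k`, `‖wopt − wstar k‖² ≤ ε_w`, and
`0 < η ≤ 1/(2L)` with `ζ = 2η(1 − 2ηL)`:
`‖wbar − η Σ_k lam k • ∇f_k(w k) − wopt‖²
  ≤ (1 − ημ)‖wbar − wopt‖² + (ηL²ε_w/2)(ζ + 4η) + (1 + ζ/(2η)) Σ_k lam k ‖w k − wbar‖²`. -/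
theorem stmt_9 {E : Type*} [NormedAddCommGroup E] [InnerProductSpace ℝ E] [CompleteSpace E]
    (K : ℕ) (hK : 1 ≤ K) (f : Fin K → E → ℝ) (μ L : ℝ) (hμ : 0 < μ) (hL : 0 < L)
    (hdiff : ∀ k, Differentiable ℝ (f k))
    (hsc : ∀ k, ∀ a b : E,
      f k b ≥ f k a + ⟪gradient (f k) a, b - a⟫ + (μ / 2) * ‖b - a‖ ^ 2)
    (hsmooth : ∀ k, ∀ a b : E, ‖gradient (f k) a - gradient (f k) b‖ ≤ L * ‖a - b‖)
    (wstar : Fin K → E) (hmin : ∀ k, ∀ x : E, f k (wstar k) ≤ f k x)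
    (lam : Fin K → ℝ) (hlam : ∀ k, 0 ≤ lam k) (hsum : ∑ k, lam k = 1)
    (wopt : E) (hopt : ∀ x : E, ∑ k, lam k * f k wopt ≤ ∑ k, lam k * f k x)
    (εw : ℝ) (hεw : 0 ≤ εw) (hdev : ∀ k, ‖wopt - wstar k‖ ^ 2 ≤ εw)
    (η : ℝ) (hη : 0 < η) (hη2 : η ≤ 1 / (2 * L))
    (ζ : ℝ) (hζ : ζ = 2 * η * (1 - 2 * η * L))
    (w : Fin K → E) (wbar : E) (hwbar : wbar = ∑ k, lam k • w k) :
    ‖wbar - η • (∑ k, lam k • gradient (f k) (w k)) - wopt‖ ^ 2 ≤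
      (1 - η * μ) * ‖wbar - wopt‖ ^ 2 + (η * L ^ 2 * εw / 2) * (ζ + 4 * η) +
        (1 + ζ / (2 * η)) * ∑ k, lam k * ‖w k - wbar‖ ^ 2 := by
  have hηL : η * L ≤ 1 / 2 := by
    rw [le_div_iff₀ (by positivity)] at hη2
    linarith
  have hζη : ζ / (2 * η) = 1 - 2 * η * L := by
    rw [hζ]
    field_simp
  have hcoef : 0 ≤ 2 * η * (1 - 2 * η * L) :=
    mul_nonneg (by positivity) (by linarith)
  have hone : ∀ c : E, ∑ k, lam k • c = c := fun c => by
    rw [← Finset.sum_smul, hsum, one_smul]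
  have hone' : ∀ c : ℝ, ∑ k, lam k * c = c := fun c => by
    rw [← Finset.sum_mul, hsum, one_mul]
  have hstep : wbar - η • (∑ k, lam k • gradient (f k) (w k)) - wopt
      = ∑ k, lam k • (wbar - η • gradient (f k) (w k) - wopt) := by
    simp only [smul_sub, Finset.sum_sub_distrib, hone, Finset.smul_sum]
    simp only [smul_comm η]
  have hmean : ‖wbar - wopt‖ ^ 2 ≤ ∑ k, lam k * ‖w k - wopt‖ ^ 2 := by
    have h := norm_sq_sum_smul_le lam hlam hsum (fun k => w k - wopt)
    simpa only [smul_sub, Finset.sum_sub_distrib, hone, ← hwbar] using h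
  have hgap : 0 ≤ ∑ k, lam k * (f k wbar - f k wopt) := by
    simp only [mul_sub, Finset.sum_sub_distrib]
    exact sub_nonneg.2 (hopt wbar)
  have hterm : ∀ k, ‖wbar - η • gradient (f k) (w k) - wopt‖ ^ 2 ≤
      ‖wbar - wopt‖ ^ 2 - η * μ * ‖w k - wopt‖ ^ 2
      + (1 + ζ / (2 * η)) * ‖w k - wbar‖ ^ 2
      - 2 * η * (1 - 2 * η * L) * (1 - η * L) * (f k wbar - f k wopt)
      + (η * L ^ 2 * εw / 2) * (ζ + 4 * η) := fun k => by
    have h := norm_sub_smul_gradient_sub_sq_le (hdiff k) hL (hsmooth k) hμ.le (hsc k)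
      (hmin k) hη hηL wbar (w k) wopt
    have hsub : f k wopt - f k (wstar k) ≤ L / 2 * εw :=
      (sub_le_of_isMin (hdiff k) (hsmooth k) (hmin k) wopt).trans
        (mul_le_mul_of_nonneg_left (hdev k) (by positivity))
    have hc : 0 ≤ η * L * (2 * η * (1 - 2 * η * L) + 4 * η) := by positivity
    have hsub' := mul_le_mul_of_nonneg_left hsub hc
    rw [hζη, hζ]
    linarith
  have htotal : ∑ k, lam k * ‖wbar - η • gradient (f k) (w k) - wopt‖ ^ 2 ≤
      ‖wbar - wopt‖ ^ 2 - η * μ * ∑ k, lam k * ‖w k - wopt‖ ^ 2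
      + (1 + ζ / (2 * η)) * ∑ k, lam k * ‖w k - wbar‖ ^ 2
      - 2 * η * (1 - 2 * η * L) * (1 - η * L) * ∑ k, lam k * (f k wbar - f k wopt)
      + (η * L ^ 2 * εw / 2) * (ζ + 4 * η) := by
    refine (Finset.sum_le_sum fun k _ =>
      mul_le_mul_of_nonneg_left (hterm k) (hlam k)).trans_eq ?_
    simp only [mul_add (lam _), mul_sub (lam _) (_ + _), mul_sub (lam _) (_ ^ 2),
      Finset.sum_add_distrib, Finset.sum_sub_distrib, hone', mul_left_comm (lam _),
      ← Finset.mul_sum]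
  have hmean' := mul_le_mul_of_nonneg_left hmean (by positivity : 0 ≤ η * μ)
  have hgap' := mul_nonneg (mul_nonneg hcoef (by linarith : 0 ≤ 1 - η * L)) hgap
  rw [hstep]
  refine (norm_sq_sum_smul_le lam hlam hsum _).trans ?_
  linarith
end
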